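/- arXiv:0907.5504 — 6 statements merged into one kernel-verified Lean document; each statement's English description precedes it below -/
import Mathlib

section
/- Let d ≥ 2, let a < b be real numbers, and let h : [a,b] → ℝ^d be a map of class C^∞ such that h'(u) ≠ 0 for every u ∈ [a,b]. Then there exist maps f₂, …, f_d : [a,b] → ℝ^d of class C^∞ such that for every u ∈ [a,b] the family (h'(u)/‖h'(u)‖₂, f₂(u), …, f_d(u)) is a direct (positively oriented) orthonormal basis of ℝ^d. -/
open Set

/-- A smooth curve in dimension at least three misses some direction altogether. -/
theorem exists_unit_forall_smul_ne {E : Type*} [NormedAddCommGroup E] [InnerProductSpace ℝ E]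
    [FiniteDimensional ℝ E] (hE : 2 < Module.finrank ℝ E) {s : Set ℝ} (hs : Convex ℝ s)
    (hne : s.Nonempty) {T : ℝ → E} (hT : ContDiffOn ℝ 1 T s) :
    ∃ v : E, ‖v‖ = 1 ∧ ∀ u ∈ s, ∀ r : ℝ, r • T u ≠ v := by
  have hF : ContDiffOn ℝ 1 (fun p : ℝ × ℝ => p.1 • T p.2) (univ ×ˢ s) :=
    contDiffOn_fst.smul (hT.comp contDiffOn_snd fun p hp => hp.2)
  have hdim : dimH ((univ : Set ℝ) ×ˢ s) < Module.finrank ℝ E := by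
    refine (dimH_mono (subset_univ _)).trans_lt ?_
    rw [Real.dimH_univ_eq_finrank]
    simpa using hE
  obtain ⟨w, hw⟩ := (hF.dense_compl_image_of_dimH_lt_finrank
    (convex_univ.prod hs) subset_rfl hdim).nonempty
  have hw' : ∀ u ∈ s, ∀ r : ℝ, r • T u ≠ w := fun u hu r hr =>
    hw ⟨(r, u), ⟨mem_univ _, hu⟩, hr⟩
  have hw0 : w ≠ 0 := by
    obtain ⟨u, hu⟩ := hne
    intro h0
    exact hw' u hu 0 (by simp [h0])
  refine ⟨‖w‖⁻¹ • w, norm_smul_inv_norm (𝕜 := ℝ) hw0, fun u hu r hr => ?_⟩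
  refine hw' u hu (‖w‖ * r) ?_
  rw [mul_smul, hr, smul_inv_smul₀ (norm_ne_zero_iff.2 hw0)]

/-- In dimension at least three, a unit vector is the first vector of a negatively oriented
orthonormal family. -/
theorem exists_orthonormal_det_eq_neg_one {d : ℕ} (hd : 3 ≤ d) {v : EuclideanSpace ℝ (Fin d)}
    (hv : ‖v‖ = 1) :
    ∃ e : Fin d → EuclideanSpace ℝ (Fin d), e ⟨0, by omega⟩ = v ∧ Orthonormal ℝ e ∧
      (EuclideanSpace.basisFun (Fin d) ℝ).toBasis.det e = -1 := by
  have hv' : Orthonormal ℝ (({⟨0, by omega⟩} : Set (Fin d)).domRestrict fun _ => v) := by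
    refine ⟨fun _ => hv, fun i j hij => (hij (Subsingleton.elim i j)).elim⟩
  obtain ⟨b, hb⟩ := hv'.exists_orthonormalBasis_extension_of_card_eq (by simp)
  have hb0 : b ⟨0, by omega⟩ = v := hb _ rfl
  rcases (EuclideanSpace.basisFun (Fin d) ℝ).det_to_matrix_orthonormalBasis_real b with h | h
  · have hne : (⟨1, by omega⟩ : Fin d) ≠ ⟨2, by omega⟩ := by simp
    refine ⟨b ∘ Equiv.swap ⟨1, by omega⟩ ⟨2, by omega⟩, ?_,
      b.orthonormal.comp _ (Equiv.injective _), ?_⟩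
    · rw [Function.comp_apply, Equiv.swap_apply_of_ne_of_ne (by simp) (by simp), hb0]
    · rw [AlternatingMap.map_swap _ _ hne, h]
  · exact ⟨b, hb0, b.orthonormal, h⟩

/-- The reflection exchanging the unit vectors `v` and `w` depends smoothly on `w ≠ v`. -/
theorem contDiffOn_reflection_sub {E : Type*} [NormedAddCommGroup E] [InnerProductSpace ℝ E]
    {n : WithTop ℕ∞} {s : Set ℝ} {T : ℝ → E} (hT : ContDiffOn ℝ n T s) {v : E}
    (hv : ∀ u ∈ s, T u ≠ v) (x : E) :
    ContDiffOn ℝ n (fun u => (ℝ ∙ (v - T u))ᗮ.reflection x) s := by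
  simp only [Submodule.reflection_orthogonal_apply, Submodule.reflection_singleton_apply]
  have hsub : ContDiffOn ℝ n (fun u => v - T u) s := contDiffOn_const.sub hT
  have hne : ∀ u ∈ s, ((‖v - T u‖ : ℝ)) ^ 2 ≠ 0 := fun u hu =>
    pow_ne_zero 2 (norm_ne_zero_iff.2 (sub_ne_zero.2 (hv u hu).symm))
  exact ((((hsub.inner ℝ contDiffOn_const).div (hsub.norm_sq ℝ) hne).smul hsub).const_smul
    (2 : ℕ) |>.sub contDiffOn_const).neg

/-- A smooth unit vector field along an interval is the first vector of a smooth direct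
orthonormal frame. -/
theorem exists_contDiffOn_direct_orthonormal_frame {d : ℕ} (hd : 2 ≤ d) {n : WithTop ℕ∞}
    (hn : 1 ≤ n) {s : Set ℝ} (hs : Convex ℝ s) (hne : s.Nonempty)
    {T : ℝ → EuclideanSpace ℝ (Fin d)} (hT : ContDiffOn ℝ n T s) (hT1 : ∀ u ∈ s, ‖T u‖ = 1) :
    ∃ f : Fin d → ℝ → EuclideanSpace ℝ (Fin d),
      (∀ j, ContDiffOn ℝ n (f j) s) ∧
      ∀ u ∈ s, f ⟨0, two_pos.trans_le hd⟩ u = T u ∧ Orthonormal ℝ (fun j => f j u) ∧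
        (EuclideanSpace.basisFun (Fin d) ℝ).toBasis.det (fun j => f j u) = 1 := by
  obtain rfl | hd3 : d = 2 ∨ 3 ≤ d := by omega
  · have hsq : ∀ u ∈ s, T u 0 * T u 0 + T u 1 * T u 1 = 1 := fun u hu => by
      have h := EuclideanSpace.real_norm_sq_eq (T u)
      rw [hT1 u hu, Fin.sum_univ_two] at h
      linarith
    have hcoord := contDiffOn_euclidean.1 hT
    refine ⟨![T, fun u => !₂[-T u 1, T u 0]], ?_, fun u hu => ⟨rfl, ?_, ?_⟩⟩
    · intro j
      fin_cases j
      · exact hT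
      · refine contDiffOn_euclidean.2 fun i => ?_
        fin_cases i
        · exact (hcoord 1).neg
        · exact hcoord 0
    · simp only [orthonormal_iff_ite, PiLp.inner_apply, Fin.sum_univ_two]
      intro i j
      have h := hsq u hu
      fin_cases i <;> fin_cases j <;>
        simp <;> linarith
    · have h := hsq u hu
      simp [Module.Basis.det_apply, Matrix.det_fin_two, Module.Basis.toMatrix_apply]
      linarith
  · obtain ⟨v, hv1, hv⟩ := exists_unit_forall_smul_ne
      (by rwa [finrank_euclideanSpace_fin]) hs hne (hT.of_le hn)
    have hTv : ∀ u ∈ s, T u ≠ v := fun u hu h => hv u hu 1 (by rw [one_smul, h])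
    obtain ⟨e, he0, he, hdet⟩ := exists_orthonormal_det_eq_neg_one hd3 hv1
    refine ⟨fun j u => (ℝ ∙ (v - T u))ᗮ.reflection (e j),
      fun j => contDiffOn_reflection_sub hT hTv (e j), fun u hu => ⟨?_, ?_, ?_⟩⟩
    · simp only [he0]
      exact Submodule.reflection_sub (hv1.trans (hT1 u hu).symm)
    · exact he.comp_linearIsometryEquiv _
    · have hcomp := (EuclideanSpace.basisFun (Fin d) ℝ).toBasis.det_comp
        (ℝ ∙ (v - T u))ᗮ.reflection.toLinearMap e
      rw [Submodule.det_reflection, Submodule.orthogonal_orthogonal,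
        finrank_span_singleton (sub_ne_zero.2 (hTv u hu).symm), hdet] at hcomp
      refine Eq.trans ?_ (hcomp.trans (by norm_num))
      rfl

theorem stmt2 {d : ℕ} (hd : 2 ≤ d) (a b : ℝ) (hab : a < b)
    (h : ℝ → EuclideanSpace ℝ (Fin d))
    (hsm : ContDiffOn ℝ (⊤ : ℕ∞) h (Set.Icc a b))
    (hder : ∀ u ∈ Set.Icc a b, derivWithin h (Set.Icc a b) u ≠ 0) :
    ∃ f : Fin d → ℝ → EuclideanSpace ℝ (Fin d),
      (∀ j, ContDiffOn ℝ (⊤ : ℕ∞) (f j) (Set.Icc a b)) ∧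
      ∀ u ∈ Set.Icc a b,
        f ⟨0, by omega⟩ u
            = ‖derivWithin h (Set.Icc a b) u‖⁻¹ • derivWithin h (Set.Icc a b) u ∧
        Orthonormal ℝ (fun j => f j u) ∧
        (EuclideanSpace.basisFun (Fin d) ℝ).toBasis.det (fun j => f j u) = 1 := by
  have hD : ContDiffOn ℝ (⊤ : ℕ∞) (derivWithin h (Icc a b)) (Icc a b) :=
    ((contDiffOn_infty_iff_derivWithin (uniqueDiffOn_Icc hab)).1 hsm).2
  exact exists_contDiffOn_direct_orthonormal_frame hd (by exact_mod_cast le_top) (convex_Icc a b)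
    (nonempty_Icc.2 hab.le)
    (((hD.norm ℝ hder).inv fun u hu => norm_ne_zero_iff.2 (hder u hu)).smul hD)
    fun u hu => norm_smul_inv_norm (𝕜 := ℝ) (hder u hu)
end

section
/- For all real numbers a < b there exists a strictly increasing bijection g : [a,b) → [a,∞) of class C^∞ such that g(a) = a and all derivatives of g of order ≥ 1 vanish at a. -/
theorem expNegInvGlue_strictMonoOn : StrictMonoOn expNegInvGlue (Set.Ici 0) := by
  intro x hx y _ hxy
  rcases (Set.mem_Ici.1 hx).eq_or_lt with rfl | hx
  · simpa using expNegInvGlue.pos_of_pos hxy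
  · simpa [expNegInvGlue, hx.not_ge, (hx.trans hxy).not_ge] using
      inv_strictAnti₀ hx hxy

/-- If a function that is smooth at `a` is constant on `(-∞, a]`, then all its derivatives of
positive order vanish at `a`. -/
theorem iteratedDeriv_eq_zero_of_eqOn_Iic_const {f : ℝ → ℝ} {a c : ℝ} {n : ℕ} (hn : 1 ≤ n)
    (hf : ContDiffAt ℝ n f a) (hc : Set.EqOn f (fun _ ↦ c) (Set.Iic a)) :
    iteratedDeriv n f a = 0 := by
  rw [← iteratedDerivWithin_eq_iteratedDeriv (uniqueDiffOn_Iic a) hf Set.self_mem_Iic,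
    iteratedDerivWithin_congr hc Set.self_mem_Iic, iteratedDerivWithin_const,
    if_neg (by lia)]

theorem stmt4 (a b : ℝ) (hab : a < b) :
    ∃ g : ℝ → ℝ,
      StrictMonoOn g (Set.Ico a b) ∧
      g '' Set.Ico a b = Set.Ici a ∧
      ContDiffOn ℝ (⊤ : ℕ∞) g (Set.Ico a b) ∧
      g a = a ∧
      (∀ n : ℕ, 1 ≤ n → iteratedDerivWithin n g (Set.Ico a b) a = 0) := by
  have hsmooth : ContDiff ℝ (⊤ : ℕ∞) fun x ↦ expNegInvGlue (x - a) :=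
    expNegInvGlue.contDiff.comp (contDiff_id.sub contDiff_const)
  have hg : ∀ x < b, ContDiffAt ℝ (⊤ : ℕ∞)
      (fun x ↦ a + expNegInvGlue (x - a) / (b - x)) x := fun x hx ↦
    contDiffAt_const.add <| hsmooth.contDiffAt.div (contDiffAt_const.sub contDiffAt_id)
      (sub_pos.2 hx).ne'
  refine ⟨fun x ↦ a + expNegInvGlue (x - a) / (b - x), ?_, ?_,
    fun x hx ↦ (hg x hx.2).contDiffWithinAt, by simp, fun n hn ↦ ?_⟩
  · intro x hx y hy hxy
    have hlt : expNegInvGlue (x - a) < expNegInvGlue (y - a) :=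
      expNegInvGlue_strictMonoOn (sub_nonneg.2 hx.1) (sub_nonneg.2 hy.1) (by linarith)
    exact add_lt_add_right (div_lt_div₀ hlt (by linarith) (expNegInvGlue.nonneg _)
      (sub_pos.2 hy.2)) a
  · refine Set.Subset.antisymm ?_ fun y hy ↦ ?_
    · rintro _ ⟨x, hx, rfl⟩
      exact le_add_of_nonneg_right
        (div_nonneg (expNegInvGlue.nonneg _) (sub_nonneg.2 hx.2.le))
    · have hya : 0 ≤ y - a := sub_nonneg.2 hy
      have hcont : ContinuousOn (fun x ↦ expNegInvGlue (x - a) - (y - a) * (b - x))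
          (Set.Icc a b) :=
        (hsmooth.continuous.sub (by fun_prop)).continuousOn
      have hpos : 0 < expNegInvGlue (b - a) := expNegInvGlue.pos_of_pos (sub_pos.2 hab)
      obtain ⟨x, hx, hx0⟩ := intermediate_value_Icc hab.le hcont (show (0 : ℝ) ∈ _ by
        simpa using ⟨mul_nonneg hya (sub_pos.2 hab).le, hpos.le⟩)
      have hxb : x < b := by
        refine hx.2.lt_of_ne ?_
        rintro rfl
        simp only [sub_self, mul_zero, sub_zero] at hx0
        exact hpos.ne' hx0
      refine ⟨x, ⟨hx.1, hxb⟩, ?_⟩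
      have hne : b - x ≠ 0 := (sub_pos.2 hxb).ne'
      simp only [sub_eq_zero.1 hx0, mul_div_cancel_right₀ _ hne, add_sub_cancel]
  · have hga := (hg a hab).of_le (m := n) (by exact_mod_cast le_top)
    rw [iteratedDerivWithin_eq_iteratedDeriv (uniqueDiffOn_Ico a b) hga
      (Set.left_mem_Ico.2 hab)]
    refine iteratedDeriv_eq_zero_of_eqOn_Iic_const (c := a) hn hga fun x hx ↦ ?_
    simp [expNegInvGlue.zero_of_nonpos (sub_nonpos.2 hx)]
end

section
/- For all integers d ≥ 2 and p ≥ 1 there exists a constant c = c(d,p) > 0 such that for any unit vectors v₁, …, v_p of ℝ^d there exists an orthonormal basis (e₁, …, e_d) of ℝ^d satisfying min(‖e_j − v_i‖₂, ‖e_j + v_i‖₂) ≥ c for all i ∈ {1, …, p} and j ∈ {1, …, d}. -/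
open Module in
/-- Reflecting a fixed orthonormal basis in a generic line makes it avoid any given finite set. -/
theorem OrthonormalBasis.exists_forall_notMem_finset {ι E : Type*} [Fintype ι]
    [NormedAddCommGroup E] [InnerProductSpace ℝ E] [FiniteDimensional ℝ E]
    (hE : 2 ≤ finrank ℝ E) (b : OrthonormalBasis ι ℝ E) (G : Finset E) :
    ∃ e : OrthonormalBasis ι ℝ E, ∀ j, e j ∉ G := by
  classical
  let W : ι × E → Subspace ℝ E := fun q =>
    if q.2 + b q.1 = 0 then (ℝ ∙ b q.1)ᗮ else ℝ ∙ (q.2 + b q.1)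
  have hW : ∀ q, W q ≠ ⊤ := by
    intro q hq
    by_cases h : q.2 + b q.1 = 0
    · simp only [W, if_pos h] at hq
      have h1 : b q.1 ∈ (ℝ ∙ b q.1)ᗮ := hq ▸ Submodule.mem_top
      rw [Submodule.mem_orthogonal_singleton_iff_inner_right, inner_self_eq_zero] at h1
      exact b.toBasis.ne_zero q.1 (by simpa using h1)
    · simp only [W, if_neg h] at hq
      have h1 := finrank_span_singleton (K := ℝ) h
      rw [hq, finrank_top] at h1
      omega
  have hne := Subspace.biUnion_ne_univ_of_top_notMem
    (s := (Finset.univ ×ˢ G).image W) (by simpa using fun a x _ => hW (a, x))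
  obtain ⟨u, hu⟩ := (Set.ne_univ_iff_exists_notMem _).1 hne
  refine ⟨b.map (ℝ ∙ u).reflection, fun j hj => hu ?_⟩
  rw [OrthonormalBasis.map_apply] at hj
  refine Set.mem_biUnion (x := W (j, (ℝ ∙ u).reflection (b j))) ?_ ?_
  · exact Finset.mem_image_of_mem W (Finset.mem_product.2 ⟨Finset.mem_univ _, hj⟩)
  · have hR : (ℝ ∙ u).reflection (b j) + b j = (2 : ℝ) • (ℝ ∙ u).starProjection (b j) := by
      rw [Submodule.reflection_apply, two_smul, two_smul]; abel
    by_cases h : (ℝ ∙ u).reflection (b j) + b j = 0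
    · simp only [W, if_pos h, SetLike.mem_coe]
      rw [h, eq_comm, smul_eq_zero_iff_right two_ne_zero,
        Submodule.starProjection_apply_eq_zero_iff] at hR
      rw [Submodule.mem_orthogonal_singleton_iff_inner_right] at hR ⊢
      rwa [real_inner_comm]
    · simp only [W, if_neg h, SetLike.mem_coe]
      have hm : (ℝ ∙ u).reflection (b j) + b j ∈ ℝ ∙ u := by
        rw [hR]
        exact Submodule.smul_mem _ _ (Submodule.starProjection_apply_mem _ _)
      obtain ⟨a, ha⟩ := Submodule.mem_span_singleton.1 hm
      have ha0 : a ≠ 0 := by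
        rintro rfl
        exact h (by rw [← ha, zero_smul])
      rw [← ha]
      exact Submodule.mem_span_singleton.2 ⟨a⁻¹, inv_smul_smul₀ ha0 u⟩

open Module in
/-- There are infinitely many orthonormal bases, no two of which share a vector up to sign. -/
theorem OrthonormalBasis.exists_seq_ne_and_ne_neg {ι E : Type*} [Fintype ι]
    [NormedAddCommGroup E] [InnerProductSpace ℝ E] [FiniteDimensional ℝ E]
    (hE : 2 ≤ finrank ℝ E) (b : OrthonormalBasis ι ℝ E) :
    ∃ B : ℕ → OrthonormalBasis ι ℝ E,
      ∀ m n, m < n → ∀ j k, B m j ≠ B n k ∧ B m j ≠ -B n k := by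
  classical
  obtain ⟨B, -, hB⟩ := exists_seq_of_forall_finset_exists
    (fun _ : OrthonormalBasis ι ℝ E => True)
    (fun e f => ∀ j k, e j ≠ f k ∧ e j ≠ -f k) (by
      intro s _
      obtain ⟨f, hf⟩ := b.exists_forall_notMem_finset hE
        ((s ×ˢ Finset.univ).image (fun q => q.1 q.2) ∪
          (s ×ˢ Finset.univ).image (fun q => -q.1 q.2))
      refine ⟨f, trivial, fun e he j k => ⟨fun h => hf k ?_, fun h => hf k ?_⟩⟩
      · exact Finset.mem_union_left _ (Finset.mem_image.2 ⟨(e, j), by simp [he], h⟩)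
      · exact Finset.mem_union_right _ (Finset.mem_image.2 ⟨(e, j), by simp [he], by simp [h]⟩))
  exact ⟨B, hB⟩

theorem stmt6 (d p : ℕ) (hd : 2 ≤ d) (hp : 1 ≤ p) :
    ∃ c > (0 : ℝ), ∀ v : Fin p → EuclideanSpace ℝ (Fin d),
      (∀ i, ‖v i‖ = 1) →
      ∃ e : OrthonormalBasis (Fin d) ℝ (EuclideanSpace ℝ (Fin d)),
        ∀ (i : Fin p) (j : Fin d), c ≤ min ‖e j - v i‖ ‖e j + v i‖ := by
  obtain ⟨B, hB⟩ := (EuclideanSpace.basisFun (Fin d) ℝ).exists_seq_ne_and_ne_neg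
    (by simpa using hd)
  have hsep : ∀ᶠ c : ℝ in nhdsWithin 0 (Set.Ioi 0), ∀ (m n : Fin (p + 1)) (j k : Fin d),
      m < n → 2 * c < ‖B m j - B n k‖ ∧ 2 * c < ‖B m j + B n k‖ := by
    have small : ∀ r : ℝ, 0 < r → ∀ᶠ c : ℝ in nhdsWithin 0 (Set.Ioi 0), 2 * c < r := by
      intro r hr
      filter_upwards [Ioo_mem_nhdsGT (half_pos hr)] with c hc
      linarith [hc.2]
    simp only [Filter.eventually_all]
    intro m n j k hmn
    have h := hB m n hmn j k
    exact (small _ (norm_pos_iff.2 (sub_ne_zero.2 h.1))).and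
      (small _ (norm_pos_iff.2 fun h0 => h.2 (eq_neg_of_add_eq_zero_left h0)))
  obtain ⟨c, hc, hc0⟩ := (hsep.and self_mem_nhdsWithin).exists
  refine ⟨c, hc0, fun v _ => ?_⟩
  by_contra! hcon
  choose i j hij using fun n : Fin (p + 1) => hcon (B n)
  obtain ⟨m, n, hmn, him⟩ : ∃ m n : Fin (p + 1), m < n ∧ i m = i n := by
    obtain ⟨m, n, hne, h⟩ := Fintype.exists_ne_map_eq_of_card_lt i (by simp)
    rcases hne.lt_or_gt with hlt | hlt
    · exact ⟨m, n, hlt, h⟩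
    · exact ⟨n, m, hlt, h.symm⟩
  obtain ⟨h1, h2⟩ := hc m n (j m) (j n) hmn
  have hm := hij m
  have hn := hij n
  rw [← him] at hn
  generalize B m (j m) = x at *
  generalize B n (j n) = y at *
  generalize v (i m) = w at *
  rcases min_lt_iff.1 hm with hm | hm <;> rcases min_lt_iff.1 hn with hn | hn
  · have := norm_sub_le (x - w) (y - w)
    rw [show x - w - (y - w) = x - y by abel] at this
    linarith
  · have := norm_add_le (x - w) (y + w)
    rw [show x - w + (y + w) = x + y by abel] at this
    linarith
  · have := norm_add_le (x + w) (y - w)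
    rw [show x + w + (y - w) = x + y by abel] at this
    linarith
  · have := norm_sub_le (x + w) (y + w)
    rw [show x + w - (y + w) = x - y by abel] at this
    linarith
end

section
/- Let d ≥ 2, let U be a connected open subset of ℝ^d, let y₁ ≠ y₂ be two points of U and let δ > 0. Then there exists a constant c > 0, depending only on U, y₁, y₂ and δ (and not on S), such that the following holds: for every set S ⊆ U that is closed in U, satisfies d₂(S, {y₁, y₂}) ≥ δ, and is such that y₁ and y₂ lie in two different connected components of U ∖ S, one has ℋ^{d-1}(S) ≥ c. -/
open MeasureTheory Metric Set
open scoped ENNReal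

/-- `x` and `y` lie in a common preconnected subset of `V \ S`. -/
def JoinedAvoiding {X : Type*} [TopologicalSpace X] (V S : Set X) (x y : X) : Prop :=
  ∃ K ⊆ V \ S, IsPreconnected K ∧ x ∈ K ∧ y ∈ K

section JoinedAvoiding

variable {X : Type*} [TopologicalSpace X] {V S : Set X} {x y z : X}

lemma JoinedAvoiding.symm (h : JoinedAvoiding V S x y) : JoinedAvoiding V S y x := by
  obtain ⟨K, hK, hc, hx, hy⟩ := h
  exact ⟨K, hK, hc, hy, hx⟩

lemma JoinedAvoiding.trans (h : JoinedAvoiding V S x y) (h' : JoinedAvoiding V S y z) :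
    JoinedAvoiding V S x z := by
  obtain ⟨K, hK, hc, hx, hy⟩ := h
  obtain ⟨L, hL, hc', hy', hz⟩ := h'
  exact ⟨K ∪ L, union_subset hK hL, hc.union y hy hy' hc', Or.inl hx, Or.inr hz⟩

lemma JoinedAvoiding.connectedComponentIn_eq (h : JoinedAvoiding V S x y) :
    connectedComponentIn (V \ S) x = connectedComponentIn (V \ S) y := by
  obtain ⟨K, hK, hc, hx, hy⟩ := h
  exact _root_.connectedComponentIn_eq (hc.subset_connectedComponentIn hx hK hy)

lemma JoinedAvoiding.image {Y : Type*} [TopologicalSpace Y] {W T : Set Y} {f : X → Y}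
    (hf : Continuous f) (hW : MapsTo f (V \ S) (W \ T)) (h : JoinedAvoiding V S x y) :
    JoinedAvoiding W T (f x) (f y) := by
  obtain ⟨K, hK, hc, hx, hy⟩ := h
  exact ⟨f '' K, (hW.mono_left hK).image_subset, hc.image f hf.continuousOn,
    mem_image_of_mem f hx, mem_image_of_mem f hy⟩

end JoinedAvoiding

section Translates

variable {n : ℕ}

/-- The volume of the small translations `v` for which `S` separates `x + v` from `y + v` in `V`
is controlled by the `n`-dimensional Hausdorff measure of `S`. -/
def TranslatesControlled (V : Set (Fin (n + 1) → ℝ)) (x y : Fin (n + 1) → ℝ) : Prop :=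
  ∃ C : ℝ≥0∞, C ≠ ∞ ∧ ∃ ε : ℝ, 0 < ε ∧ ∀ S : Set (Fin (n + 1) → ℝ),
    volume {v ∈ ball (0 : Fin (n + 1) → ℝ) ε | ¬ JoinedAvoiding V S (x + v) (y + v)} ≤
      C * μH[(n : ℝ)] S

variable {V : Set (Fin (n + 1) → ℝ)} {x y z : Fin (n + 1) → ℝ}

lemma TranslatesControlled.symm (h : TranslatesControlled V x y) :
    TranslatesControlled V y x := by
  obtain ⟨C, hC, ε, hε, h⟩ := h
  refine ⟨C, hC, ε, hε, fun S => (measure_mono ?_).trans (h S)⟩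
  exact fun v hv => ⟨hv.1, fun hj => hv.2 hj.symm⟩

lemma TranslatesControlled.trans (h : TranslatesControlled V x y)
    (h' : TranslatesControlled V y z) : TranslatesControlled V x z := by
  obtain ⟨C, hC, ε, hε, h⟩ := h
  obtain ⟨C', hC', ε', hε', h'⟩ := h'
  refine ⟨C + C', ENNReal.add_ne_top.2 ⟨hC, hC'⟩, min ε ε', lt_min hε hε', fun S => ?_⟩
  rw [add_mul]
  refine le_trans (measure_mono ?_) ((measure_union_le _ _).trans (add_le_add (h S) (h' S)))
  rintro v ⟨hv, hj⟩
  by_cases hxy : JoinedAvoiding V S (x + v) (y + v)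
  · exact Or.inr ⟨ball_subset_ball (min_le_right _ _) hv, fun hyz => hj (hxy.trans hyz)⟩
  · exact Or.inl ⟨ball_subset_ball (min_le_left _ _) hv, hxy⟩

lemma lipschitzWith_removeNth (i : Fin (n + 1)) :
    LipschitzWith 1 (fun v : Fin (n + 1) → ℝ => i.removeNth v) := by
  refine .of_edist_le fun v w => ?_
  rw [edist_pi_le_iff]
  exact fun j => edist_le_pi_edist v w (i.succAbove j)

lemma volume_removeNth_image_le (i : Fin (n + 1)) (S : Set (Fin (n + 1) → ℝ)) :
    volume (i.removeNth '' S : Set (Fin n → ℝ)) ≤ μH[(n : ℝ)] S := by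
  have h := (lipschitzWith_removeNth i).hausdorffMeasure_image_le (Nat.cast_nonneg n) S
  have hv := hausdorffMeasure_pi_real (ι := Fin n)
  rw [Fintype.card_fin] at hv
  rw [hv] at h
  simpa using h

lemma volume_setOf_removeNth_mem (i : Fin (n + 1)) (J : Set ℝ) (T : Set (Fin n → ℝ)) :
    volume {v : Fin (n + 1) → ℝ | v i ∈ J ∧ i.removeNth v ∈ T} = volume J * volume T := by
  rw [← Measure.prod_prod, ← Measure.volume_eq_prod,
    ← (volume_preserving_piFinSuccAbove (fun _ => ℝ) i).measure_preimage_equiv]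
  rfl

lemma translatesControlled_update {r : ℝ} (hr : 0 < r) (i : Fin (n + 1)) (t : ℝ)
    (hV : ball z (r + r) ⊆ V) (hx : x ∈ ball z r) (hy : Function.update x i t ∈ ball z r) :
    TranslatesControlled V x (Function.update x i t) := by
  refine ⟨volume (ball (0 : ℝ) r), measure_ball_lt_top.ne, r, hr, fun S => ?_⟩
  refine le_trans (measure_mono ?_) ((volume_setOf_removeNth_mem i (ball 0 r)
    ((fun w => i.removeNth x + w) ⁻¹' (i.removeNth '' S))).trans_le ?_)
  · rintro v ⟨hv, hj⟩
    have hvr : ‖v‖ < r := by simpa using hv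
    have hmem : ∀ p ∈ ball z r, p + v ∈ ball z (r + r) := by
      intro p hp
      rw [mem_ball_iff_norm] at hp ⊢
      calc ‖p + v - z‖ = ‖(p - z) + v‖ := by congr 1; abel
        _ ≤ ‖p - z‖ + ‖v‖ := norm_add_le _ _
        _ < r + r := add_lt_add hp hvr
    refine ⟨by simpa using (norm_le_pi_norm v i).trans_lt hvr, ?_⟩
    have hseg : segment ℝ (x + v) (Function.update x i t + v) ⊆ V :=
      ((convex_ball z (r + r)).segment_subset (hmem _ hx) (hmem _ hy)).trans hV
    have hnot : ¬ Disjoint (segment ℝ (x + v) (Function.update x i t + v)) S := fun hd =>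
      hj ⟨_, subset_sdiff.2 ⟨hseg, hd⟩, (convex_segment _ _).isPreconnected,
        left_mem_segment _ _ _, right_mem_segment _ _ _⟩
    obtain ⟨s, ⟨a, b, -, -, hab, rfl⟩, hsS⟩ := not_disjoint_iff.1 hnot
    refine ⟨_, hsS, funext fun j => ?_⟩
    simp only [Fin.removeNth, Pi.add_apply, Pi.smul_apply, smul_eq_mul, ne_eq,
      Fin.succAbove_ne, not_false_eq_true, Function.update_of_ne]
    rw [← add_mul, hab, one_mul]
  · rw [measure_preimage_add]
    gcongr
    exact volume_removeNth_image_le i S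

lemma translatesControlled_of_mem_ball {r : ℝ} (hr : 0 < r) (hV : ball x (r + r) ⊆ V)
    (hy : y ∈ ball x r) : TranslatesControlled V x y := by
  have hpw : ∀ s : Finset (Fin (n + 1)), s.piecewise y x ∈ ball x r := by
    intro s
    rw [mem_ball, dist_pi_lt_iff hr]
    intro j
    by_cases hj : j ∈ s
    · simpa [hj] using (dist_le_pi_dist y x j).trans_lt hy
    · simpa [hj] using hr
  have key : ∀ s : Finset (Fin (n + 1)), TranslatesControlled V x (s.piecewise y x) := by
    intro s
    induction s using Finset.induction_on with
    | empty =>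
      have h := translatesControlled_update (x := x) hr 0 (x 0) hV (mem_ball_self hr)
        (by simpa using hr)
      simpa using h
    | insert j s _ ih =>
      have hj := hpw (insert j s)
      rw [Finset.piecewise_insert] at hj ⊢
      exact ih.trans (translatesControlled_update hr j (y j) hV (hpw s) hj)
  simpa using key Finset.univ

lemma IsPreconnected.translatesControlled (hV : IsPreconnected V) (hVo : IsOpen V)
    (hx : x ∈ V) (hy : y ∈ V) : TranslatesControlled V x y := by
  refine hV.induction₂ _ (fun z hz => ?_) (fun _ _ _ _ _ _ => .trans) (fun _ _ _ _ => .symm) hx hy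
  obtain ⟨r, hr, hrV⟩ := isOpen_iff.1 hVo z hz
  filter_upwards [mem_nhdsWithin_of_mem_nhds (ball_mem_nhds z (half_pos hr))] with w hw
  exact translatesControlled_of_mem_ball (half_pos hr) (by rwa [add_halves]) hw

lemma exists_le_hausdorffMeasure_of_not_joinedAvoiding (hV : IsPreconnected V) (hVo : IsOpen V)
    {x y : Fin (n + 1) → ℝ} (hx : x ∈ V) (hy : y ∈ V) {r : ℝ} (hr : 0 < r)
    (hxr : ball x r ⊆ V) (hyr : ball y r ⊆ V) :
    ∃ c : ℝ≥0∞, 0 < c ∧ ∀ S : Set (Fin (n + 1) → ℝ), Disjoint (ball x r) S →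
      Disjoint (ball y r) S → ¬ JoinedAvoiding V S x y → c ≤ μH[(n : ℝ)] S := by
  obtain ⟨C, hC, ε, hε, h⟩ := hV.translatesControlled hVo hx hy
  have hm : 0 < min ε r := lt_min hε hr
  refine ⟨volume (ball (0 : Fin (n + 1) → ℝ) (min ε r)) / C,
    ENNReal.div_pos (measure_ball_pos _ _ hm).ne' hC, fun S hxS hyS hS => ?_⟩
  refine ENNReal.div_le_of_le_mul' (le_trans (measure_mono fun v hv => ?_) (h S))
  refine ⟨ball_subset_ball (min_le_left _ _) hv, fun hj => hS ?_⟩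
  have hvr : ‖v‖ < r := by simpa using ball_subset_ball (min_le_right ε r) hv
  have near : ∀ p, ball p r ⊆ V → Disjoint (ball p r) S → JoinedAvoiding V S p (p + v) :=
    fun p hp hpS => ⟨ball p r, subset_sdiff.2 ⟨hp, hpS⟩, (convex_ball p r).isPreconnected,
      mem_ball_self hr, by simpa using hvr⟩
  exact ((near x hxr hxS).trans hj).trans (near y hyr hyS).symm

end Translates

theorem stmt7 {d : ℕ} (hd : 2 ≤ d) (U : Set (EuclideanSpace ℝ (Fin d)))
    (hUopen : IsOpen U) (hUconn : IsConnected U)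
    (y₁ y₂ : EuclideanSpace ℝ (Fin d)) (hy₁ : y₁ ∈ U) (hy₂ : y₂ ∈ U) (hne : y₁ ≠ y₂)
    (δ : ℝ) (hδ : 0 < δ) :
    ∃ c : ℝ≥0∞, 0 < c ∧ ∀ S : Set (EuclideanSpace ℝ (Fin d)), S ⊆ U →
      IsClosed {x : U | (x : EuclideanSpace ℝ (Fin d)) ∈ S} →
      (∀ x ∈ S, δ ≤ dist x y₁ ∧ δ ≤ dist x y₂) →
      connectedComponentIn (U \ S) y₁ ≠ connectedComponentIn (U \ S) y₂ →
      c ≤ μH[(d : ℝ) - 1] S := by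
  obtain ⟨n, rfl⟩ : ∃ n, d = n + 1 := ⟨d - 1, by omega⟩
  have hcont : Continuous (WithLp.toLp 2 : (Fin (n + 1) → ℝ) → EuclideanSpace ℝ (Fin (n + 1))) :=
    PiLp.continuous_toLp 2 _
  have hVo : IsOpen (WithLp.toLp 2 ⁻¹' U : Set (Fin (n + 1) → ℝ)) := hUopen.preimage hcont
  have himage (T : Set (EuclideanSpace ℝ (Fin (n + 1)))) :
      (WithLp.toLp 2 ⁻¹' T : Set (Fin (n + 1) → ℝ)) = WithLp.ofLp '' T :=
    ((WithLp.equiv 2 (Fin (n + 1) → ℝ)).image_eq_preimage_symm T).symm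
  have hV : IsPreconnected (WithLp.toLp 2 ⁻¹' U : Set (Fin (n + 1) → ℝ)) := by
    rw [himage]
    exact hUconn.isPreconnected.image _ (PiLp.continuous_ofLp 2 _).continuousOn
  have hball (y : EuclideanSpace ℝ (Fin (n + 1))) (hy : y ∈ U) :
      ∃ r > 0, ball y.ofLp r ⊆ WithLp.toLp 2 ⁻¹' (U ∩ ball y δ) :=
    isOpen_iff.1 ((hUopen.inter isOpen_ball).preimage hcont) _ ⟨hy, mem_ball_self hδ⟩
  obtain ⟨r₁, hr₁, h₁⟩ := hball y₁ hy₁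
  obtain ⟨r₂, hr₂, h₂⟩ := hball y₂ hy₂
  replace h₁ := (ball_subset_ball (min_le_left r₁ r₂)).trans h₁
  replace h₂ := (ball_subset_ball (min_le_right r₁ r₂)).trans h₂
  obtain ⟨c, hc, h⟩ := exists_le_hausdorffMeasure_of_not_joinedAvoiding hV hVo
    (x := y₁.ofLp) (y := y₂.ofLp) hy₁ hy₂ (lt_min hr₁ hr₂)
    (fun v hv => (h₁ hv).1) (fun v hv => (h₂ hv).1)
  refine ⟨c, hc, fun S _ _ hdist hcomp => ?_⟩
  have hle := h (WithLp.toLp 2 ⁻¹' S)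
    (disjoint_left.2 fun v hv hvS => (hdist _ hvS).1.not_gt (h₁ hv).2)
    (disjoint_left.2 fun v hv hvS => (hdist _ hvS).2.not_gt (h₂ hv).2)
    (fun hj => hcomp (hj.image hcont fun v hv => hv).connectedComponentIn_eq)
  refine hle.trans ?_
  have hLip := (PiLp.lipschitzWith_ofLp 2 (fun _ : Fin (n + 1) => ℝ)).hausdorffMeasure_image_le
    (Nat.cast_nonneg n) S
  rw [himage]
  simpa using hLip
end

section
/- Let d ≥ 2 and let ν be a nonnegative real-valued function on the unit sphere S^{d-1} of ℝ^d with ν(−v) = ν(v) for all v. Suppose ν satisfies the weak triangle inequality: for every nondegenerate triangle (A,B,C) in ℝ^d, denoting by v_A, v_B, v_C the unit vectors lying in the plane spanned by A, B, C that are orthogonal respectively to the sides [BC], [AC], [AB] and point towards the exterior of the triangle (i.e. v_C is orthogonal to B − A, lies in the plane of the triangle, and has nonpositive inner product with C minus the midpoint of [AB], and similarly for v_A, v_B), one has ℋ¹([AB]) ν(v_C) ≤ ℋ¹([AC]) ν(v_B) + ℋ¹([BC]) ν(v_A). Then the homogeneous extension ν₀ : ℝ^d → [0,∞), defined by ν₀(0)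 = 0 and ν₀(w) = ‖w‖₂ ν(w/‖w‖₂) for w ≠ 0, is a convex function on ℝ^d. -/
open scoped RealInnerProductSpace

section Gram

variable {E : Type*} [NormedAddCommGroup E] [InnerProductSpace ℝ E]

/-- Up to a positive factor, `gramRotate u v w` is the vector `w` of the plane spanned by
`u` and `v`, rotated by a right angle. -/
def gramRotate (u v w : E) : E := ⟪u, w⟫ • v - ⟪v, w⟫ • u

theorem gramRotate_add (u v w z : E) :
    gramRotate u v (w + z) = gramRotate u v w + gramRotate u v z := by
  simp only [gramRotate, inner_add_right]
  module

theorem inner_gramRotate_self (u v w : E) : ⟪w, gramRotate u v w⟫ = 0 := by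
  simp only [gramRotate, inner_sub_right, inner_smul_right, real_inner_comm w]
  ring

theorem norm_gramRotate_add_smul (u v : E) (a b : ℝ) :
    ‖gramRotate u v (a • u + b • v)‖
      = √(⟪u, u⟫ * ⟪v, v⟫ - ⟪u, v⟫ ^ 2) * ‖a • u + b • v‖ := by
  have hG : 0 ≤ ⟪u, u⟫ * ⟪v, v⟫ - ⟪u, v⟫ ^ 2 := by
    have := real_inner_mul_inner_self_le u v
    nlinarith
  refine (sq_eq_sq₀ (norm_nonneg _) (by positivity)).1 ?_
  rw [mul_pow, Real.sq_sqrt hG, ← real_inner_self_eq_norm_sq, ← real_inner_self_eq_norm_sq]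
  simp only [gramRotate, inner_add_left, inner_add_right, inner_sub_left, inner_sub_right,
    real_inner_smul_left, inner_smul_right, real_inner_comm u v]
  ring

theorem gram_smul_left (u v : E) :
    (⟪u, u⟫ * ⟪v, v⟫ - ⟪u, v⟫ ^ 2) • u
      = ⟪u, v⟫ • gramRotate u v u - ⟪u, u⟫ • gramRotate u v v := by
  simp only [gramRotate, real_inner_comm u v]
  module

theorem gram_smul_right (u v : E) :
    (⟪u, u⟫ * ⟪v, v⟫ - ⟪u, v⟫ ^ 2) • v
      = ⟪v, v⟫ • gramRotate u v u - ⟪u, v⟫ • gramRotate u v v := by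
  simp only [gramRotate, real_inner_comm u v]
  module

end Gram

/-- The positively homogeneous extension of an even function on the unit sphere is absolutely
homogeneous. -/
theorem norm_mul_normalize_smul {E : Type*} [NormedAddCommGroup E] [NormedSpace ℝ E] {ν : E → ℝ}
    (hsymm : ∀ v : E, ‖v‖ = 1 → ν (-v) = ν v) (r : ℝ) (w : E) :
    ‖r • w‖ * ν (‖r • w‖⁻¹ • r • w) = |r| * (‖w‖ * ν (‖w‖⁻¹ • w)) := by
  rcases eq_or_ne w 0 with rfl | hw
  · simp
  have hw' : ‖w‖ ≠ 0 := norm_ne_zero_iff.2 hw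
  have hu : ‖‖w‖⁻¹ • w‖ = 1 := by rw [norm_smul, norm_inv, norm_norm, inv_mul_cancel₀ hw']
  rw [norm_smul, Real.norm_eq_abs, mul_assoc]
  rcases lt_trichotomy r 0 with hr | rfl | hr
  · rw [abs_of_neg hr]
    have : (-r * ‖w‖)⁻¹ • r • w = -(‖w‖⁻¹ • w) := by
      rw [smul_smul, ← neg_smul]
      congr 1
      field_simp
      rw [div_self hr.ne]
    rw [this, hsymm _ hu]
  · simp
  · rw [abs_of_pos hr]
    have : (r * ‖w‖)⁻¹ • r • w = ‖w‖⁻¹ • w := by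
      rw [smul_smul]
      congr 1
      field_simp
    rw [this]

theorem stmt10 {d : ℕ} (hd : 2 ≤ d) (ν : EuclideanSpace ℝ (Fin d) → ℝ)
    (hnn : ∀ v : EuclideanSpace ℝ (Fin d), ‖v‖ = 1 → 0 ≤ ν v)
    (hsymm : ∀ v : EuclideanSpace ℝ (Fin d), ‖v‖ = 1 → ν (-v) = ν v)
    (htri : ∀ A B C vA vB vC : EuclideanSpace ℝ (Fin d),
      ¬ Collinear ℝ ({A, B, C} : Set (EuclideanSpace ℝ (Fin d))) →
      ‖vA‖ = 1 → ‖vB‖ = 1 → ‖vC‖ = 1 →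
      vA ∈ Submodule.span ℝ ({B - A, C - A} : Set (EuclideanSpace ℝ (Fin d))) →
      vB ∈ Submodule.span ℝ ({B - A, C - A} : Set (EuclideanSpace ℝ (Fin d))) →
      vC ∈ Submodule.span ℝ ({B - A, C - A} : Set (EuclideanSpace ℝ (Fin d))) →
      ⟪vA, C - B⟫ = 0 → ⟪vA, A - midpoint ℝ B C⟫ ≤ 0 →
      ⟪vB, C - A⟫ = 0 → ⟪vB, B - midpoint ℝ A C⟫ ≤ 0 →
      ⟪vC, B - A⟫ = 0 → ⟪vC, C - midpoint ℝ A B⟫ ≤ 0 →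
      ‖B - A‖ * ν vC ≤ ‖C - A‖ * ν vB + ‖C - B‖ * ν vA) :
    ConvexOn ℝ Set.univ (fun w : EuclideanSpace ℝ (Fin d) => ‖w‖ * ν (‖w‖⁻¹ • w)) := by
  have hom := norm_mul_normalize_smul hsymm
  set F : EuclideanSpace ℝ (Fin d) → ℝ := fun w => ‖w‖ * ν (‖w‖⁻¹ • w) with hF
  have hom' : ∀ (r : ℝ) w, F (r • w) = |r| * F w := hom
  have unit : ∀ w : EuclideanSpace ℝ (Fin d), w ≠ 0 → ‖‖w‖⁻¹ • w‖ = 1 := fun w hw => by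
    rw [norm_smul, norm_inv, norm_norm, inv_mul_cancel₀ (norm_ne_zero_iff.2 hw)]
  have nonneg : ∀ w, 0 ≤ F w := fun w => by
    rcases eq_or_ne w 0 with rfl | hw
    · simp [hF]
    · exact mul_nonneg (norm_nonneg _) (hnn _ (unit w hw))
  have subadd : ∀ u v, F (u + v) ≤ F u + F v := by
    intro u v
    have hG : 0 ≤ ⟪u, u⟫ * ⟪v, v⟫ - ⟪u, v⟫ ^ 2 := by
      have := real_inner_mul_inner_self_le u v
      nlinarith
    have hp := norm_gramRotate_add_smul u v 1 0
    have hq := norm_gramRotate_add_smul u v 0 1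
    have hpq := norm_gramRotate_add_smul u v 1 1
    have hu := gram_smul_left u v
    have hv := gram_smul_right u v
    have hup := inner_gramRotate_self u v u
    have hvq := inner_gramRotate_self u v v
    have huvpq := inner_gramRotate_self u v (u + v)
    have hvp : ⟪v, gramRotate u v u⟫ = ⟪u, u⟫ * ⟪v, v⟫ - ⟪u, v⟫ ^ 2 := by
      simp only [gramRotate, inner_sub_right, inner_smul_right, real_inner_comm u v]
      ring
    have huq : ⟪u, gramRotate u v v⟫ = -(⟪u, u⟫ * ⟪v, v⟫ - ⟪u, v⟫ ^ 2) := by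
      simp only [gramRotate, inner_sub_right, inner_smul_right]
      ring
    have hp_def : gramRotate u v u = ⟪u, u⟫ • v - ⟪v, u⟫ • u := rfl
    simp only [one_smul, zero_smul, add_zero, zero_add] at hp hq hpq
    rw [gramRotate_add] at huvpq hpq
    generalize gramRotate u v u = p at *
    generalize gramRotate u v v = q at *
    rcases hG.eq_or_lt with hG0 | hGpos
    · rcases eq_or_ne u 0 with rfl | hu0
      · simpa using nonneg 0
      rw [← hG0, Real.sqrt_zero, zero_mul, norm_eq_zero] at hp
      have huu : ⟪u, u⟫ ≠ 0 := inner_self_ne_zero.2 hu0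
      obtain ⟨r, rfl⟩ : ∃ r : ℝ, v = r • u := by
        refine ⟨⟪u, u⟫⁻¹ * ⟪v, u⟫, ?_⟩
        rw [mul_smul, ← sub_eq_zero.1 (hp_def.symm.trans hp), smul_smul, inv_mul_cancel₀ huu,
          one_smul]
      calc F (u + r • u) = |1 + r| * F u := by rw [← hom', add_smul, one_smul]
        _ ≤ (1 + |r|) * F u := by
          gcongr
          · exact nonneg u
          · simpa using abs_add_le 1 r
        _ = F u + F (r • u) := by rw [hom']; ring
    have hk := Real.sqrt_pos.2 hGpos
    have ne : ∀ a b : ℝ, a • u + b • v = 0 → a = 0 ∧ b = 0 := by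
      intro a b h
      have h1 : ⟪a • u + b • v, q⟫ = 0 := by rw [h, inner_zero_left]
      have h2 : ⟪a • u + b • v, p⟫ = 0 := by rw [h, inner_zero_left]
      simp only [inner_add_left, real_inner_smul_left, hup, hvp, huq, hvq] at h1 h2
      constructor
      · nlinarith
      · nlinarith
    have hu0 : u ≠ 0 := by
      rintro rfl
      simpa using ne 1 0 (by simp)
    have hv0 : v ≠ 0 := by
      rintro rfl
      simpa using ne 0 1 (by simp)
    have huv0 : u + v ≠ 0 := fun h => by
      simpa using ne 1 1 (by simpa using h)
    have hmem : ∀ x ∈ ({u, v} : Set (EuclideanSpace ℝ (Fin d))),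
        x ∈ Submodule.span ℝ ({p + q - 0, p - 0} : Set (EuclideanSpace ℝ (Fin d))) := by
      intro x hx
      rw [← Submodule.smul_mem_iff _ hGpos.ne']
      rw [Submodule.mem_span_pair]
      rcases hx with rfl | rfl
      · refine ⟨-⟪x, x⟫, ⟪x, v⟫ + ⟪x, x⟫, ?_⟩
        rw [hu]
        module
      · refine ⟨-⟪u, x⟫, ⟪x, x⟫ + ⟪u, x⟫, ?_⟩
        rw [hv]
        module
    have hmu := hmem u (by simp)
    have hmv := hmem v (by simp)
    have hnc : ¬ Collinear ℝ ({0, p + q, p} : Set (EuclideanSpace ℝ (Fin d))) := by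
      intro hc
      obtain ⟨w, hw⟩ := (collinear_iff_of_mem (Set.mem_insert 0 _)).1 hc
      obtain ⟨r, hr⟩ := hw (p + q) (by simp)
      obtain ⟨s, hs⟩ := hw p (by simp)
      simp only [vadd_eq_add, add_zero] at hr hs
      have hqw : q = (r - s) • w := by rw [sub_smul, ← hr, ← hs]; abel
      have huw : ⟪u, w⟫ * s = 0 := by rw [← hup, hs, inner_smul_right]; ring
      have hvw : ⟪v, w⟫ * s = ⟪u, u⟫ * ⟪v, v⟫ - ⟪u, v⟫ ^ 2 := by
        rw [← hvp, hs, inner_smul_right]; ring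
      have huw' : (r - s) * ⟪u, w⟫ = -(⟪u, u⟫ * ⟪v, v⟫ - ⟪u, v⟫ ^ 2) := by
        rw [← huq, hqw, inner_smul_right]
      rcases mul_eq_zero.1 huw with h | h
      · rw [h] at huw'; linarith
      · rw [h] at hvw; linarith
    have key := htri 0 (p + q) p (‖v‖⁻¹ • v) (‖u‖⁻¹ • u) (-(‖u + v‖⁻¹ • (u + v))) hnc
      (unit v hv0) (unit u hu0) (by rw [norm_neg, unit _ huv0])
      (Submodule.smul_mem _ _ hmv) (Submodule.smul_mem _ _ hmu)
      (Submodule.neg_mem _ (Submodule.smul_mem _ _ (Submodule.add_mem _ hmu hmv)))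
      (by simp [real_inner_smul_left, hvq])
      (by
        rw [real_inner_smul_left]
        refine mul_nonpos_of_nonneg_of_nonpos (by positivity) ?_
        simp only [midpoint_eq_smul_add, invOf_eq_inv, inner_sub_right, inner_smul_right,
          inner_add_right, inner_zero_right, hvp, hvq]
        linarith)
      (by simp [real_inner_smul_left, hup])
      (by
        rw [real_inner_smul_left]
        refine mul_nonpos_of_nonneg_of_nonpos (by positivity) ?_
        simp only [midpoint_eq_smul_add, invOf_eq_inv, inner_sub_right, inner_smul_right,
          inner_add_right, inner_zero_right, hup, huq]
        linarith)
      (by rw [sub_zero, inner_neg_left, real_inner_smul_left, huvpq, mul_zero, neg_zero])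
      (by
        rw [inner_neg_left, real_inner_smul_left, neg_nonpos]
        refine mul_nonneg (by positivity) ?_
        simp only [midpoint_eq_smul_add, invOf_eq_inv, zero_add, inner_sub_right, inner_smul_right,
          huvpq]
        simp only [inner_add_left, hup, hvp]
        linarith)
    rw [hsymm _ (unit _ huv0), sub_zero, sub_zero, sub_add_cancel_left, norm_neg, hp, hq, hpq,
      mul_assoc, mul_assoc, mul_assoc, ← mul_add] at key
    exact le_of_mul_le_mul_left key hk
  refine ⟨convex_univ, fun x _ y _ a b ha hb _ => ?_⟩
  calc F (a • x + b • y) ≤ F (a • x) + F (b • y) := subadd _ _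
    _ = a • F x + b • F y := by rw [hom', hom', abs_of_nonneg ha, abs_of_nonneg hb]; rfl
end

section
/- Let d ≥ 2, let a < b be real numbers, let h : [a,b] → ℝ^d be an injective map of class C^∞ with h'(u) ≠ 0 for all u ∈ [a,b], and let f₂, …, f_d : [a,b] → ℝ^d be maps of class C^∞ such that for every u ∈ [a,b] the family (h'(u)/‖h'(u)‖₂, f₂(u), …, f_d(u)) is an orthonormal basis of ℝ^d. Then there exists η > 0 such that the map Φ : [a,b] × {t ∈ ℝ^{d-1} : ‖t‖₂ ≤ η} → ℝ^d defined by Φ(u, (t₂, …, t_d)) = h(u) + t₂ f₂(u) + ⋯ + t_d f_d(u) is injective. -/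
open Set Metric

/-- A `C¹` curve on a compact interval is uniformly approximated by its tangent lines. -/
theorem exists_forall_norm_sub_sub_smul_derivWithin_le {E : Type*} [NormedAddCommGroup E]
    [NormedSpace ℝ E] {a b : ℝ} (hab : a < b) {h : ℝ → E} (hh : ContDiffOn ℝ 1 h (Icc a b))
    {ε : ℝ} (hε : 0 < ε) :
    ∃ δ > 0, ∀ u ∈ Icc a b, ∀ v ∈ Icc a b, dist u v < δ →
      ‖h u - h v - (u - v) • derivWithin h (Icc a b) v‖ ≤ ε * |u - v| := by
  have hd : ContinuousOn (derivWithin h (Icc a b)) (Icc a b) :=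
    hh.continuousOn_derivWithin (uniqueDiffOn_Icc hab) le_rfl
  obtain ⟨δ, hδ, H⟩ := uniformContinuousOn_iff.1
    (isCompact_Icc.uniformContinuousOn_of_continuous hd) ε hε
  refine ⟨δ, hδ, fun u hu v hv huv => ?_⟩
  have key := Convex.norm_image_sub_le_of_norm_hasDerivWithin_le
    (s := Icc a b ∩ ball v δ) (C := ε) (x := v) (y := u)
    (f := fun x => h x - x • derivWithin h (Icc a b) v)
    (f' := fun x => derivWithin h (Icc a b) x - (1 : ℝ) • derivWithin h (Icc a b) v)
    (fun x hx => (((hh.differentiableOn one_ne_zero x hx.1).hasDerivWithinAt).mono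
      inter_subset_left).sub ((hasDerivWithinAt_id x _).smul_const _))
    (fun x hx => by
      rw [one_smul, ← dist_eq_norm]
      exact (H x hx.1 v hv hx.2).le)
    ((convex_Icc a b).inter (convex_ball v δ)) ⟨hv, mem_ball_self hδ⟩ ⟨hu, huv⟩
  rw [Real.norm_eq_abs] at key
  refine le_of_eq_of_le ?_ key
  congr 1
  rw [sub_smul]
  abel

/-- A continuous injective map on a compact set separates distant points uniformly. -/
theorem IsCompact.exists_forall_le_dist_of_injOn {X Y : Type*} [PseudoMetricSpace X]
    [MetricSpace Y] {s : Set X} (hs : IsCompact s) {h : X → Y} (hc : ContinuousOn h s)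
    (hinj : InjOn h s) {δ : ℝ} (hδ : 0 < δ) :
    ∃ m > 0, ∀ u ∈ s, ∀ v ∈ s, δ ≤ dist u v → m ≤ dist (h u) (h v) := by
  have hK : IsCompact ((s ×ˢ s) ∩ {p : X × X | δ ≤ dist p.1 p.2}) :=
    (hs.prod hs).inter_right (isClosed_le continuous_const continuous_dist)
  have hcont : ContinuousOn (fun p : X × X => dist (h p.1) (h p.2))
      ((s ×ˢ s) ∩ {p : X × X | δ ≤ dist p.1 p.2}) :=
    continuous_dist.comp_continuousOn ((hc.comp continuousOn_fst fun _ hp => hp.1.1).prodMk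
      (hc.comp continuousOn_snd fun _ hp => hp.1.2))
  obtain ⟨m, hm, H⟩ := hK.exists_forall_le' hcont (a := 0) fun p hp => by
    refine dist_pos.2 fun heq => ?_
    have hp2 : δ ≤ dist p.1 p.2 := hp.2
    rw [hinj hp.1.1 hp.1.2 heq, dist_self] at hp2
    exact hp2.not_gt hδ
  exact ⟨m, hm, fun u hu v hv huv => H (u, v) ⟨⟨hu, hv⟩, huv⟩⟩

/-- The map `(u, t) ↦ h u + ∑ i, t i • f i u` attached to an injective immersed `C¹` arc `h` and a
`C¹` orthonormal family `f` of normal fields is injective for small `t`. -/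
theorem exists_injOn_tubular {E ι : Type*} [NormedAddCommGroup E] [InnerProductSpace ℝ E]
    [Fintype ι] {a b : ℝ} (hab : a < b) {h : ℝ → E} (hh : ContDiffOn ℝ 1 h (Icc a b))
    (hinj : InjOn h (Icc a b)) (hder : ∀ u ∈ Icc a b, derivWithin h (Icc a b) u ≠ 0)
    {f : ι → ℝ → E} (hf : ∀ i, ContDiffOn ℝ 1 (f i) (Icc a b))
    (hon : ∀ u ∈ Icc a b, Orthonormal ℝ fun i => f i u)
    (hperp : ∀ u ∈ Icc a b, ∀ i, inner ℝ (f i u) (derivWithin h (Icc a b) u) = 0) :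
    ∃ η > (0 : ℝ), InjOn (fun p : ℝ × EuclideanSpace ℝ ι => h p.1 + ∑ i, p.2 i • f i p.1)
      (Icc a b ×ˢ closedBall 0 η) := by
  have hd : ContinuousOn (derivWithin h (Icc a b)) (Icc a b) :=
    hh.continuousOn_derivWithin (uniqueDiffOn_Icc hab) le_rfl
  obtain ⟨c, hc, hcle⟩ := isCompact_Icc.exists_forall_le' hd.norm (a := 0)
    fun u hu => norm_pos_iff.2 (hder u hu)
  have hlip : ∀ i, ∃ K, LipschitzOnWith K (f i) (Icc a b) := fun i =>
    ((hf i).locallyLipschitzOn (convex_Icc a b)).exists_lipschitzOnWith_of_compact isCompact_Icc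
  choose K hK using hlip
  obtain ⟨δ, hδ, happrox⟩ := exists_forall_norm_sub_sub_smul_derivWithin_le hab hh (half_pos hc)
  obtain ⟨m, hm, hsep⟩ := isCompact_Icc.exists_forall_le_dist_of_injOn hh.continuousOn hinj hδ
  set L : ℝ := ∑ i, (K i : ℝ) with hL
  have hL0 : 0 ≤ L := Finset.sum_nonneg fun i _ => (K i).2
  set N : ℝ := (Fintype.card ι : ℝ) with hN
  have hN0 : 0 ≤ N := Nat.cast_nonneg _
  obtain ⟨η, hη, hη1, hη2⟩ : ∃ η > (0 : ℝ), η * L < c / 2 ∧ 2 * (N * η) < m := by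
    refine ⟨min (c / 2 / (L + 1)) (m / (2 * N + 1)), by positivity, ?_, ?_⟩
    · calc _ ≤ c / 2 / (L + 1) * L := by gcongr; exact min_le_left _ _
        _ < c / 2 := by
          rw [div_mul_eq_mul_div, div_lt_iff₀ (by positivity)]
          nlinarith
    · calc _ ≤ 2 * (N * (m / (2 * N + 1))) := by gcongr; exact min_le_right _ _
        _ = 2 * N * m / (2 * N + 1) := by ring
        _ < m := by
          rw [div_lt_iff₀ (by positivity)]
          nlinarith
  have hcoord : ∀ t ∈ closedBall (0 : EuclideanSpace ℝ ι) η, ∀ i, |t i| ≤ η := fun t ht i =>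
    (PiLp.norm_apply_le t i).trans (mem_closedBall_zero_iff.1 ht)
  have hsum : ∀ u ∈ Icc a b, ∀ t ∈ closedBall (0 : EuclideanSpace ℝ ι) η,
      ‖∑ i, t i • f i u‖ ≤ N * η := fun u hu t ht =>
    (norm_sum_le_of_le _ (n := fun _ => η) fun i _ => by
      rw [norm_smul, (hon u hu).1 i, mul_one]
      exact hcoord t ht i).trans_eq (by simp [hN])
  refine ⟨η, hη, ?_⟩
  rintro ⟨u, s⟩ ⟨hu, hs⟩ ⟨v, t⟩ ⟨hv, ht⟩ heq
  dsimp only at hu hs hv ht heq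
  have hdiff : h u - h v = ∑ i, t i • f i v - ∑ i, s i • f i u := by
    rw [sub_eq_sub_iff_add_eq_add, heq, add_comm]
  have huv : u = v := by
    by_contra hne
    have hpos : 0 < |u - v| := abs_pos.2 (sub_ne_zero.2 hne)
    have hclose : dist u v < δ := by
      by_contra! hfar
      have h1 := hsep u hu v hv hfar
      rw [dist_eq_norm, hdiff] at h1
      linarith [norm_sub_le (∑ i, t i • f i v) (∑ i, s i • f i u), hsum u hu s hs, hsum v hv t ht]
    set T := derivWithin h (Icc a b) v with hT
    have hTc : c ≤ ‖T‖ := hcle v hv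
    have hinner : inner ℝ (h u - h v) T = -∑ i, s i * inner ℝ (f i u - f i v) T := by
      rw [hdiff, inner_sub_left, sum_inner, sum_inner]
      simp [inner_smul_left, inner_sub_left, hT, hperp v hv]
    have hupper : |inner ℝ (h u - h v) T| ≤ η * L * |u - v| * ‖T‖ := by
      rw [hinner, abs_neg, hL, Finset.mul_sum, Finset.sum_mul, Finset.sum_mul]
      refine (Finset.abs_sum_le_sum_abs _ _).trans (Finset.sum_le_sum fun i _ => ?_)
      have hi : ‖f i u - f i v‖ ≤ K i * |u - v| := by
        simpa [dist_eq_norm] using (hK i).dist_le_mul u hu v hv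
      calc |s i * inner ℝ (f i u - f i v) T|
          = |s i| * |inner ℝ (f i u - f i v) T| := abs_mul _ _
        _ ≤ η * (K i * |u - v| * ‖T‖) := by
          gcongr
          · exact hcoord s hs i
          · exact (abs_real_inner_le_norm _ _).trans (by gcongr)
        _ = η * K i * |u - v| * ‖T‖ := by ring
    have hrest : |inner ℝ (h u - h v - (u - v) • T) T| ≤ c / 2 * |u - v| * ‖T‖ :=
      (abs_real_inner_le_norm _ _).trans (by gcongr; exact happrox u hu v hv hclose)
    have hmain : |u - v| * ‖T‖ ^ 2 ≤ (c / 2 + η * L) * |u - v| * ‖T‖ := by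
      calc |u - v| * ‖T‖ ^ 2
          = |inner ℝ (h u - h v) T - inner ℝ (h u - h v - (u - v) • T) T| := by
            rw [← inner_sub_left, sub_sub_cancel, real_inner_smul_left,
              real_inner_self_eq_norm_sq, abs_mul, abs_of_nonneg (sq_nonneg ‖T‖)]
        _ ≤ _ := (abs_sub _ _).trans (by linarith)
    have hTpos : 0 < |u - v| * ‖T‖ := mul_pos hpos (hc.trans_le hTc)
    nlinarith
  subst huv
  have hzero : ∑ i, (s i - t i) • f i u = 0 := by
    simp only [sub_smul, Finset.sum_sub_distrib]
    exact sub_eq_zero.2 (add_left_cancel heq)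
  have hst : s = t := by
    ext i
    exact sub_eq_zero.1
      (Fintype.linearIndependent_iff.1 (hon u hu).linearIndependent (fun i => s i - t i) hzero i)
  rw [hst]

theorem stmt12 {d : ℕ} (hd : 2 ≤ d) (a b : ℝ) (hab : a < b)
    (h : ℝ → EuclideanSpace ℝ (Fin d))
    (hsm : ContDiffOn ℝ (⊤ : ℕ∞) h (Set.Icc a b))
    (hinj : Set.InjOn h (Set.Icc a b))
    (hder : ∀ u ∈ Set.Icc a b, derivWithin h (Set.Icc a b) u ≠ 0)
    (f : Fin (d - 1) → ℝ → EuclideanSpace ℝ (Fin d))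
    (hfsm : ∀ i, ContDiffOn ℝ (⊤ : ℕ∞) (f i) (Set.Icc a b))
    (hONB : ∀ u ∈ Set.Icc a b,
      Orthonormal ℝ (fun j : Option (Fin (d - 1)) =>
        j.elim (‖derivWithin h (Set.Icc a b) u‖⁻¹ • derivWithin h (Set.Icc a b) u)
          (fun i => f i u)) ∧
      Submodule.span ℝ (Set.range (fun j : Option (Fin (d - 1)) =>
        j.elim (‖derivWithin h (Set.Icc a b) u‖⁻¹ • derivWithin h (Set.Icc a b) u)
          (fun i => f i u))) = ⊤) :
    ∃ η > (0 : ℝ), Set.InjOn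
      (fun p : ℝ × EuclideanSpace ℝ (Fin (d - 1)) => h p.1 + ∑ i, p.2 i • f i p.1)
      (Set.Icc a b ×ˢ Metric.closedBall 0 η) := by
  have h1 : (1 : WithTop ℕ∞) ≤ ((⊤ : ℕ∞) : WithTop ℕ∞) := mod_cast le_top
  refine exists_injOn_tubular hab (hsm.of_le h1) hinj hder (fun i => (hfsm i).of_le h1)
    (fun u hu => (hONB u hu).1.comp some (Option.some_injective _)) fun u hu i => ?_
  have h2 := (hONB u hu).1.2 (Option.some_ne_none i)
  simpa [inner_smul_right, hder u hu] using h2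
end
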